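/- Let K be a finite pseudo-reflection group on ℝⁿ and λ ∈ ℂⁿ generic (g·λ ≠ λ for all g ≠ e in K), with λ purely imaginary coordinates. Then the natural representation T_λ of G = ℝⁿ ⋊ K on the joint eigenspace E_λ = {f ∈ C^∞(ℝⁿ) : P(∂)f = P(λ)f for all K-invariant polynomials P} is irreducible, has dimension |K|, and is equivalent to the induced representation Ind_{ℝⁿ}^{G}(χ) where χ(x) = e^{−λᵀx}. -/

import Mathlib

open Matrix MvPolynomial

noncomputable section

/-- The `i`-th partial derivative operator on functions `ℝⁿ → ℂ`. -/
def pderivOp (n : ℕ) (i : Fin n) (f : (Fin n → ℝ) → ℂ) : (Fin n → ℝ) → ℂ :=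
  fun x => fderiv ℝ f x (Pi.single i 1)

/-- The constant-coefficient differential operator `P(∂)` on functions `ℝⁿ → ℂ`. -/
def diffOp {n : ℕ} (P : MvPolynomial (Fin n) ℂ) (f : (Fin n → ℝ) → ℂ) : (Fin n → ℝ) → ℂ :=
  ∑ α ∈ P.support, P.coeff α •
    ((List.finRange n).foldr (fun i g => (pderivOp n i)^[α i] ∘ g) id) f

/-- Action of `g ∈ O(n)` on polynomials: `(g·P)(x) = P(g⁻¹x)`. -/
def orthAct {n : ℕ} (g : Matrix.orthogonalGroup (Fin n) ℝ) :
    MvPolynomial (Fin n) ℂ →ₐ[ℂ] MvPolynomial (Fin n) ℂ :=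
  aeval (fun i => ∑ j, (((((g⁻¹ : Matrix.orthogonalGroup (Fin n) ℝ) :
    Matrix (Fin n) (Fin n) ℝ) i j : ℝ) : ℂ)) • (X j : MvPolynomial (Fin n) ℂ))

/-- The joint eigenspace `E_λ ⊆ C^∞(ℝⁿ)`: smooth `f` with `P(∂)f = P(λ)f` for every
`K`-invariant polynomial `P`. -/
def eigenSet {n : ℕ} (K : Subgroup (Matrix.orthogonalGroup (Fin n) ℝ))
    (lam : Fin n → ℂ) : Set ((Fin n → ℝ) → ℂ) :=
  {f | ContDiff ℝ (⊤ : ℕ∞) f ∧ ∀ P : MvPolynomial (Fin n) ℂ,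
    (∀ g ∈ K, orthAct g P = P) → diffOp P f = fun x => MvPolynomial.eval lam P * f x}

/-- The natural action of `G = ℝⁿ ⋊ K` on functions: `(T(x₀,k₀)f)(x) = f(g⁻¹·x)`
where `g·x = k₀x + x₀`. -/
def natAct {n : ℕ} (K : Subgroup (Matrix.orthogonalGroup (Fin n) ℝ))
    (x₀ : Fin n → ℝ) (k₀ : K) (f : (Fin n → ℝ) → ℂ) : (Fin n → ℝ) → ℂ :=
  fun x => f ((((k₀ : Matrix.orthogonalGroup (Fin n) ℝ)⁻¹ :
    Matrix.orthogonalGroup (Fin n) ℝ) : Matrix (Fin n) (Fin n) ℝ).mulVec (x - x₀))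

/-- Complexified action of an orthogonal matrix. -/
def cact {n : ℕ} (g : Matrix.orthogonalGroup (Fin n) ℝ) (μ : Fin n → ℂ) : Fin n → ℂ :=
  ((g : Matrix (Fin n) (Fin n) ℝ).map (Complex.ofReal)).mulVec μ

lemma cact_one {n : ℕ} (μ : Fin n → ℂ) : cact (1 : Matrix.orthogonalGroup (Fin n) ℝ) μ = μ := by
  have : ((1 : Matrix (Fin n) (Fin n) ℝ).map Complex.ofReal) = 1 := by
    ext i j; by_cases h : i = j <;> simp [Matrix.one_apply, h]
  simp [cact, this]

lemma cact_mul {n : ℕ} (g h : Matrix.orthogonalGroup (Fin n) ℝ) (μ : Fin n → ℂ) :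
    cact (g * h) μ = cact g (cact h μ) := by
  have : (((g : Matrix (Fin n) (Fin n) ℝ) * (h : Matrix (Fin n) (Fin n) ℝ)).map Complex.ofReal)
     = (g : Matrix (Fin n) (Fin n) ℝ).map Complex.ofReal * (h : Matrix (Fin n) (Fin n) ℝ).map Complex.ofReal := by
    ext i j; simp [Matrix.mul_apply]
  simp [cact, this, Matrix.mulVec_mulVec]

lemma cact_pair {n : ℕ} (g : Matrix.orthogonalGroup (Fin n) ℝ) (μ : Fin n → ℂ) (x : Fin n → ℝ) :
    ∑ i, cact g μ i * (x i : ℂ) =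
      ∑ i, μ i * ((((g⁻¹ : Matrix.orthogonalGroup (Fin n) ℝ) :
        Matrix (Fin n) (Fin n) ℝ).mulVec x i : ℝ) : ℂ) := by
  have h : ((g⁻¹ : Matrix.orthogonalGroup (Fin n) ℝ) : Matrix (Fin n) (Fin n) ℝ)
      = (g : Matrix (Fin n) (Fin n) ℝ)ᵀ := by
    rfl
  rw [h]
  simp only [cact, Matrix.mulVec, dotProduct, Matrix.map_apply, Matrix.transpose_apply,
    Complex.ofReal_sum, Complex.ofReal_mul, Finset.sum_mul, Finset.mul_sum]
  rw [Finset.sum_comm]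
  refine Finset.sum_congr rfl fun i _ => Finset.sum_congr rfl fun j _ => ?_
  ring

lemma eval_orthAct {n : ℕ} (g : Matrix.orthogonalGroup (Fin n) ℝ) (P : MvPolynomial (Fin n) ℂ)
    (μ : Fin n → ℂ) : eval μ (orthAct g P) = eval (cact g⁻¹ μ) P := by
  induction P using MvPolynomial.induction_on with
  | C a => simp [orthAct]
  | add p q hp hq => simp [hp, hq]
  | mul_X p i hp =>
    rw [map_mul, map_mul, hp, map_mul, eval_X]
    congr 1
    simp only [orthAct, aeval_X, map_sum, smul_eval, eval_X, cact, Matrix.mulVec, dotProduct,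
      Matrix.map_apply]

lemma orthAct_mul {n : ℕ} (g h : Matrix.orthogonalGroup (Fin n) ℝ) (P : MvPolynomial (Fin n) ℂ) :
    orthAct (g * h) P = orthAct g (orthAct h P) := by
  apply MvPolynomial.funext
  intro μ
  rw [eval_orthAct, eval_orthAct, eval_orthAct, _root_.mul_inv_rev, cact_mul]

lemma orthAct_one {n : ℕ} (P : MvPolynomial (Fin n) ℂ) :
    orthAct (1 : Matrix.orthogonalGroup (Fin n) ℝ) P = P := by
  apply MvPolynomial.funext
  intro μ
  rw [eval_orthAct, inv_one, cact_one]

lemma cact_inj {n : ℕ} (K : Subgroup (Matrix.orthogonalGroup (Fin n) ℝ))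
    (lam : Fin n → ℂ)
    (hgen : ∀ g : Matrix.orthogonalGroup (Fin n) ℝ, g ∈ K → g ≠ 1 → cact g lam ≠ lam)
    (g h : K) (e : cact (g : Matrix.orthogonalGroup (Fin n) ℝ) lam = cact h lam) : g = h := by
  by_contra hne
  refine hgen ((h⁻¹ * g : K) : Matrix.orthogonalGroup (Fin n) ℝ) (h⁻¹ * g).2 ?_ ?_
  · intro h1
    have h2 : h⁻¹ * g = 1 := Subtype.ext h1
    exact hne (inv_mul_eq_one.mp h2).symm
  · rw [Subgroup.coe_mul, cact_mul, e, ← cact_mul, Subgroup.coe_inv, inv_mul_cancel, cact_one]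

lemma exists_sep {n : ℕ} (K : Subgroup (Matrix.orthogonalGroup (Fin n) ℝ)) [Finite K]
    (lam : Fin n → ℂ)
    (hgen : ∀ g : Matrix.orthogonalGroup (Fin n) ℝ, g ∈ K → g ≠ 1 → cact g lam ≠ lam) :
    ∃ a : MvPolynomial (Fin n) ℂ, ∀ g h : K, eval (cact g lam) a = eval (cact h lam) a → g = h := by
  obtain ⟨φ, hφ⟩ := Module.exists_dual_forall_apply_ne_zero (K := ℂ)
    (fun p : {p : K × K // p.1 ≠ p.2} =>
      cact (p.1.1 : Matrix.orthogonalGroup (Fin n) ℝ) lam - cact (p.1.2) lam)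
    (fun p => sub_ne_zero.2 fun e => p.2 (cact_inj K lam hgen _ _ e))
  have key : ∀ μ, eval μ (∑ i, φ (Pi.single i 1) • (X i : MvPolynomial (Fin n) ℂ)) = φ μ := by
    intro μ
    simp only [map_sum, smul_eval, eval_X]
    conv_rhs => rw [pi_eq_sum_univ' μ]
    simp [map_sum, map_smul, mul_comm]
  refine ⟨∑ i, φ (Pi.single i 1) • X i, fun g h e => ?_⟩
  by_contra hne
  apply hφ ⟨(g, h), hne⟩
  rw [key, key] at e
  rw [map_sub, e, sub_self]

/-- The ideal generated by `P - P(λ)`, `P` invariant. -/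
def invIdeal {n : ℕ} (K : Subgroup (Matrix.orthogonalGroup (Fin n) ℝ))
    (lam : Fin n → ℂ) : Ideal (MvPolynomial (Fin n) ℂ) :=
  Ideal.span {c | ∃ P : MvPolynomial (Fin n) ℂ, (∀ g ∈ K, orthAct g P = P) ∧ c = P - C (eval lam P)}

lemma mem_invIdeal {n : ℕ} (K : Subgroup (Matrix.orthogonalGroup (Fin n) ℝ))
    (lam : Fin n → ℂ) (P : MvPolynomial (Fin n) ℂ) (hP : ∀ g ∈ K, orthAct g P = P) :
    P - C (eval lam P) ∈ invIdeal K lam := Ideal.subset_span ⟨P, hP, rfl⟩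

lemma invIdeal_radical {n : ℕ} (K : Subgroup (Matrix.orthogonalGroup (Fin n) ℝ)) [Finite K]
    (lam : Fin n → ℂ)
    (a : MvPolynomial (Fin n) ℂ)
    (ha : ∀ g h : K, eval (cact g lam) a = eval (cact h lam) a → g = h)
    (q : MvPolynomial (Fin n) ℂ) (hq : ∀ g : K, eval (cact g lam) q = 0) :
    q ∈ invIdeal K lam := by
  classical
  have := Fintype.ofFinite K
  obtain ⟨A, hAdef⟩ : ∃ A : K → MvPolynomial (Fin n) ℂ →ₐ[ℂ] MvPolynomial (Fin n) ℂ,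
    ∀ g : K, A g = orthAct (g : Matrix.orthogonalGroup (Fin n) ℝ) := ⟨fun g => orthAct g, fun _ => rfl⟩
  have hA : ∀ g h P, A g (A h P) = A (g * h) P := fun g h P => by
    rw [hAdef, hAdef, hAdef, Subgroup.coe_mul, orthAct_mul]
  have hA1 : ∀ P, A 1 P = P := fun P => by rw [hAdef, Subgroup.coe_one, orthAct_one]
  have hev' : ∀ (g : K) μ P, eval μ (A g P) = eval (cact (g⁻¹ : K) μ) P :=
    fun g μ P => by rw [hAdef, eval_orthAct, Subgroup.coe_inv]
  have hev : ∀ (g : K) P, eval lam (A g P) = eval (cact (g⁻¹ : K) lam) P :=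
    fun g P => hev' g lam P
  have hmem : ∀ P, (∀ g : K, A g P = P) → P - C (eval lam P) ∈ invIdeal K lam := by
    intro P hP
    refine mem_invIdeal K lam P fun g hg => ?_
    have := hP ⟨g, hg⟩
    rwa [hAdef] at this
  clear hAdef
  let H : Polynomial (MvPolynomial (Fin n) ℂ) :=
    ∑ g : K, Polynomial.C (A g q) *
      ∏ h ∈ Finset.univ.erase g, (Polynomial.X - Polynomial.C (A h a))
  have hinv : ∀ k : K, H.map (A k : MvPolynomial (Fin n) ℂ →+* MvPolynomial (Fin n) ℂ) = H := by
    intro k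
    simp only [H, Polynomial.map_sum, Polynomial.map_mul, Polynomial.map_prod, Polynomial.map_sub,
      Polynomial.map_C, Polynomial.map_X, RingHom.coe_coe, hA]
    refine Fintype.sum_equiv (Equiv.mulLeft k) _ _ fun g => ?_
    congr 1
    refine Finset.prod_equiv (Equiv.mulLeft k) ?_ ?_
    · simp
    · simp
  have hlam : H.map (eval lam) = 0 := by
    simp only [H, Polynomial.map_sum, Polynomial.map_mul, Polynomial.map_C, hev, hq]
    simp
  have hcoeff : ∀ i, H.coeff i ∈ invIdeal K lam := by
    intro i
    have h1 : eval lam (H.coeff i) = 0 := by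
      have := congrArg (fun p => Polynomial.coeff p i) hlam
      simpa using this
    have h2 := hmem (H.coeff i) (fun g => by
      have := congrArg (fun p => Polynomial.coeff p i) (hinv g)
      simpa using this)
    simpa [h1] using h2
  have hHa : H.eval a ∈ invIdeal K lam := by
    rw [Polynomial.eval_eq_sum_range]
    exact Ideal.sum_mem _ fun i _ => Ideal.mul_mem_right _ _ (hcoeff i)
  set u := ∏ h ∈ Finset.univ.erase (1 : K), (a - A h a) with hu
  have hHu : H.eval a = q * u := by
    simp only [H, Polynomial.eval_finsetSum, Polynomial.eval_mul, Polynomial.eval_prod,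
      Polynomial.eval_C, Polynomial.eval_sub, Polynomial.eval_X]
    rw [Finset.sum_eq_single (1 : K)]
    · rw [hA1]
    · intro g _ hg
      rw [Finset.prod_eq_zero (i := (1 : K)) (by simpa using hg.symm), mul_zero]
      rw [hA1, sub_self]
    · simp
  have hue : ∀ k : K, eval (cact k lam) u ≠ 0 := by
    intro k
    rw [hu, map_prod, Finset.prod_ne_zero_iff]
    intro h hh e
    rw [map_sub, sub_eq_zero] at e
    have e2 : eval (cact k lam) (A h a) = eval (cact (h⁻¹ * k : K) lam) a := by
      rw [Subgroup.coe_mul, cact_mul, hev']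
    rw [e2] at e
    have := ha _ _ e
    simp at hh
    exact hh (by simpa using this)
  set N := ∏ k : K, A k u with hN
  have hNinv : ∀ g : K, A g N = N := by
    intro g
    rw [hN, map_prod]
    simp only [hA]
    exact Fintype.prod_equiv (Equiv.mulLeft g) _ _ fun k => rfl
  have hNe : eval lam N ≠ 0 := by
    rw [hN, map_prod, Finset.prod_ne_zero_iff]
    intro k _
    rw [hev]
    exact hue _
  have hdvd : u ∣ N := by
    have := Finset.dvd_prod_of_mem (fun k : K => A k u) (Finset.mem_univ 1)
    simpa [hA1] using this
  have h1 : q * N ∈ invIdeal K lam := by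
    obtain ⟨v, hv⟩ := hdvd
    rw [hv, ← mul_assoc, ← hHu]
    exact Ideal.mul_mem_right _ _ hHa
  have h2 : q * C (eval lam N) ∈ invIdeal K lam := by
    have := Ideal.sub_mem _ h1 (Ideal.mul_mem_left _ q (hmem N hNinv))
    convert this using 1
    ring
  have h3 := Ideal.mul_mem_right (C (eval lam N)⁻¹) _ h2
  rwa [mul_assoc, ← C_mul, mul_inv_cancel₀ hNe, C_1, mul_one] at h3

lemma exists_lagr {n : ℕ} (K : Subgroup (Matrix.orthogonalGroup (Fin n) ℝ)) [Finite K]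
    (lam : Fin n → ℂ)
    (a : MvPolynomial (Fin n) ℂ)
    (ha : ∀ g h : K, eval (cact g lam) a = eval (cact h lam) a → g = h) (k : K) :
    ∃ p : MvPolynomial (Fin n) ℂ, eval (cact k lam) p = 1 ∧
      ∀ h : K, h ≠ k → eval (cact h lam) p = 0 := by
  classical
  have := Fintype.ofFinite K
  refine ⟨∏ h ∈ Finset.univ.erase k, (a - C (eval (cact h lam) a)) *
    C (eval (cact k lam) a - eval (cact h lam) a)⁻¹, ?_, ?_⟩
  · rw [map_prod]
    refine Finset.prod_eq_one fun h hh => ?_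
    simp only [map_mul, map_sub, eval_C]
    refine mul_inv_cancel₀ (sub_ne_zero.2 fun e => ?_)
    simp at hh
    exact hh (ha _ _ e).symm
  · intro h hh
    rw [map_prod]
    refine Finset.prod_eq_zero (i := h) (by simpa using hh) ?_
    simp

/-- Smooth functions. -/
def smoothSub (n : ℕ) : Submodule ℂ ((Fin n → ℝ) → ℂ) where
  carrier := {f | ContDiff ℝ (⊤ : ℕ∞) f}
  add_mem' := by
    intro f g hf hg
    rw [Set.mem_ofPred_eq] at *
    exact ContDiff.add hf hg
  zero_mem' := by
    rw [Set.mem_ofPred_eq]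
    exact contDiff_const
  smul_mem' := by
    intro c f hf
    rw [Set.mem_ofPred_eq] at *
    exact ContDiff.const_smul c hf

lemma mem_smooth {n : ℕ} {f : (Fin n → ℝ) → ℂ} : f ∈ smoothSub n ↔ ContDiff ℝ (⊤ : ℕ∞) f := Iff.rfl

lemma smooth_diff {n : ℕ} (f : smoothSub n) : Differentiable ℝ (f : (Fin n → ℝ) → ℂ) :=
  ContDiff.differentiable (mem_smooth.1 f.2) (by simp)

lemma smooth_fderiv {n : ℕ} (f : smoothSub n) :
    ContDiff ℝ (⊤ : ℕ∞) (fderiv ℝ (f : (Fin n → ℝ) → ℂ)) :=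
  ContDiff.fderiv_right (mem_smooth.1 f.2) (by exact_mod_cast le_rfl)

/-- Partial derivative as an endomorphism of smooth functions. -/
def pd {n : ℕ} (i : Fin n) : Module.End ℂ (smoothSub n) where
  toFun f := ⟨pderivOp n i f, mem_smooth.2 <| (smooth_fderiv f).clm_apply contDiff_const⟩
  map_add' f g := by
    ext x
    simp [pderivOp, fderiv_add (smooth_diff f x) (smooth_diff g x)]
  map_smul' c f := by
    ext x
    simp [pderivOp, fderiv_const_smul (smooth_diff f x) c]

lemma pd_coe {n : ℕ} (i : Fin n) (f : smoothSub n) :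
    ((pd i f : smoothSub n) : (Fin n → ℝ) → ℂ) = pderivOp n i f := rfl

lemma pd_comm {n : ℕ} (i j : Fin n) : (pd i : Module.End ℂ (smoothSub n)) * pd j = pd j * pd i := by
  have key : ∀ (i j : Fin n) (f : smoothSub n) x, pderivOp n i (pderivOp n j f) x =
      fderiv ℝ (fderiv ℝ (f : (Fin n → ℝ) → ℂ)) x (Pi.single i 1) (Pi.single j 1) := by
    intro i j f x
    unfold pderivOp
    have h := ((smooth_fderiv f).differentiable (by simp)) x
    rw [fderiv_clm_apply h (differentiableAt_const _)]
    simp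
  ext f x
  simp only [Module.End.mul_apply, pd_coe, key]
  have : IsSymmSndFDerivAt ℝ (f : (Fin n → ℝ) → ℂ) x :=
    (ContDiff.contDiffAt (mem_smooth.1 f.2)).isSymmSndFDerivAt (by
      rw [minSmoothness_of_isRCLikeNormedField]
      exact WithTop.coe_le_coe.2 (le_top (a := (2 : ℕ∞))))
  exact this _ _

lemma exists_Phi (n : ℕ) : ∃ Φ : MvPolynomial (Fin n) ℂ →ₐ[ℂ] Module.End ℂ (smoothSub n),
    (∀ i, Φ (X i) = pd i) ∧ ∀ P (f : smoothSub n), ((Φ P f : smoothSub n) : (Fin n → ℝ) → ℂ) = diffOp P f := by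
  have hc : ∀ a ∈ Set.range (pd : Fin n → Module.End ℂ (smoothSub n)),
      ∀ b ∈ Set.range (pd : Fin n → Module.End ℂ (smoothSub n)), a * b = b * a := by
    rintro _ ⟨i, rfl⟩ _ ⟨j, rfl⟩
    exact pd_comm i j
  obtain ⟨B, hBc, hB⟩ : ∃ B : Subalgebra ℂ (Module.End ℂ (smoothSub n)), IsMulCommutative B ∧
      ∀ i, pd i ∈ B :=
    ⟨_, Algebra.isMulCommutative_adjoin ℂ hc, fun i => Algebra.subset_adjoin ⟨i, rfl⟩⟩
  let _ : CommSemiring B := { (inferInstance : Semiring B) with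
    mul_comm := fun x y => hBc.is_comm.comm x y }
  let b : Fin n → B := fun i => ⟨pd i, hB i⟩
  refine ⟨B.val.comp (aeval b), ?_, ?_⟩
  · intro i
    simp [b]
  · intro P f
    have hl : ∀ (α : Fin n →₀ ℕ) (l : List (Fin n)),
        (((l.map fun i => (pd i : Module.End ℂ (smoothSub n)) ^ α i).prod f : smoothSub n) :
          (Fin n → ℝ) → ℂ) = (l.foldr (fun i g => (pderivOp n i)^[α i] ∘ g) id) f := by
      intro α l
      induction l with
      | nil => simp
      | cons i l ih =>
        simp only [List.map_cons, List.prod_cons, Module.End.mul_apply, List.foldr_cons,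
          Function.comp_apply]
        rw [← ih]
        generalize (List.map (fun i => (pd i : Module.End ℂ (smoothSub n)) ^ α i) l).prod f = g
        generalize α i = m
        induction m with
        | zero => simp
        | succ m ihm =>
          rw [pow_succ', Function.iterate_succ_apply', ← ihm]
          rfl
    rw [AlgHom.comp_apply, aeval_def, eval₂_eq', map_sum]
    simp only [diffOp, LinearMap.sum_apply, Submodule.coe_sum]
    refine Finset.sum_congr rfl fun α _ => ?_
    rw [← hl, Fin.prod_univ_def, map_mul, map_list_prod, List.map_map, AlgHom.commutes]
    simp [Module.algebraMap_end_apply, Function.comp_def, b]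

/-- The exponential function. -/
def eexp {n : ℕ} (μ : Fin n → ℂ) : smoothSub n :=
  ⟨fun x => Complex.exp (∑ i, μ i * (x i : ℂ)), by
    rw [mem_smooth]
    refine ContDiff.cexp (ContDiff.sum fun i _ => contDiff_const.mul ?_)
    exact Complex.ofRealCLM.contDiff.comp (contDiff_apply ℝ ℝ i)⟩

lemma eexp_apply {n : ℕ} (μ : Fin n → ℂ) (x : Fin n → ℝ) :
    (eexp μ : (Fin n → ℝ) → ℂ) x = Complex.exp (∑ i, μ i * (x i : ℂ)) := rfl

lemma eexp_fderiv {n : ℕ} (μ : Fin n → ℂ) (x : Fin n → ℝ) :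
    HasFDerivAt (eexp μ : (Fin n → ℝ) → ℂ)
      ((eexp μ : (Fin n → ℝ) → ℂ) x • ∑ i, μ i • (Complex.ofRealCLM.comp
        (ContinuousLinearMap.proj (R := ℝ) (φ := fun _ : Fin n => ℝ) i))) x := by
  refine HasFDerivAt.cexp (HasFDerivAt.fun_sum fun i _ => ?_)
  exact (Complex.ofRealCLM.comp (ContinuousLinearMap.proj (R := ℝ)
    (φ := fun _ : Fin n => ℝ) i)).hasFDerivAt.const_mul (μ i)

lemma pd_eexp {n : ℕ} (μ : Fin n → ℂ) (i : Fin n) : pd i (eexp μ) = μ i • eexp μ := by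
  ext x
  rw [pd_coe, pderivOp, (eexp_fderiv μ x).fderiv]
  simp [Pi.single_apply, mul_comm, apply_ite Complex.ofReal]

lemma eexp_inj {n : ℕ} (μ ν : Fin n → ℂ) (h : eexp μ = eexp ν) : μ = ν := by
  funext i
  have h1 := pd_eexp μ i
  rw [h, pd_eexp] at h1
  have := congrArg (fun f : smoothSub n => (f : (Fin n → ℝ) → ℂ) 0) h1
  simpa [eexp_apply] using this.symm

lemma eq_smul_eexp {n : ℕ} (μ : Fin n → ℂ) (f : smoothSub n) (h : ∀ i, pd i f = μ i • f) :
    ∃ c : ℂ, f = c • eexp μ := by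
  have hd : ∀ x, HasFDerivAt (fun x => (f : (Fin n → ℝ) → ℂ) x * (eexp (-μ) : (Fin n → ℝ) → ℂ) x)
      (0 : (Fin n → ℝ) →L[ℝ] ℂ) x := by
    intro x
    have h1 := (smooth_diff f x).hasFDerivAt.mul (eexp_fderiv (-μ) x)
    have e : (f : (Fin n → ℝ) → ℂ) x • ((eexp (-μ) : (Fin n → ℝ) → ℂ) x • ∑ i, (-μ) i •
        (Complex.ofRealCLM.comp (ContinuousLinearMap.proj (R := ℝ) (φ := fun _ : Fin n => ℝ) i))) +
        (eexp (-μ) : (Fin n → ℝ) → ℂ) x • fderiv ℝ (f : (Fin n → ℝ) → ℂ) x = 0 := by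
      apply ContinuousLinearMap.coe_injective
      refine LinearMap.pi_ext' fun i => LinearMap.ext_ring ?_
      have h2 : fderiv ℝ (f : (Fin n → ℝ) → ℂ) x (Pi.single i 1) = μ i * (f : (Fin n → ℝ) → ℂ) x :=
        congrArg (fun f : smoothSub n => (f : (Fin n → ℝ) → ℂ) x) (h i)
      simp [h2, Pi.single_apply, apply_ite Complex.ofReal]
      ring
    rw [e] at h1
    exact h1
  have hconst := is_const_of_fderiv_eq_zero (𝕜 := ℝ) (fun x => (hd x).differentiableAt)
    (fun x => (hd x).fderiv)
  refine ⟨(f : (Fin n → ℝ) → ℂ) 0, ?_⟩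
  ext x
  have h1 := hconst x 0
  simp only [eexp_apply, Pi.neg_apply, neg_mul, Finset.sum_neg_distrib, Complex.exp_neg] at h1
  have h2 := Complex.exp_ne_zero (∑ i, μ i * (x i : ℂ))
  simp only [Submodule.coe_smul, Pi.smul_apply, eexp_apply, smul_eq_mul]
  simp at h1
  field_simp at h1
  rw [h1, mul_comm]

lemma Phi_eexp {n : ℕ} (Φ : MvPolynomial (Fin n) ℂ →ₐ[ℂ] Module.End ℂ (smoothSub n))
    (hΦ : ∀ i, Φ (X i) = pd i) (P : MvPolynomial (Fin n) ℂ) (μ : Fin n → ℂ) :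
    Φ P (eexp μ) = eval μ P • eexp μ := by
  induction P using MvPolynomial.induction_on with
  | C a =>
    rw [← algebraMap_eq, AlgHom.commutes]
    simp [Module.algebraMap_end_apply, algebraMap_eq]
  | add p q hp hq => simp [hp, hq, add_smul]
  | mul_X p i hp => simp [hΦ, hp, pd_eexp, smul_smul, mul_comm]

lemma eexp_mem {n : ℕ} (K : Subgroup (Matrix.orthogonalGroup (Fin n) ℝ)) (lam : Fin n → ℂ)
    [Fintype K] (c : K → ℂ) :
    ((∑ k : K, c k • eexp (cact k lam) : smoothSub n) : (Fin n → ℝ) → ℂ) ∈ eigenSet K lam := by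
  obtain ⟨Φ, h1, h2⟩ := exists_Phi n
  refine ⟨mem_smooth.1 (Subtype.property _), fun P hP => ?_⟩
  have hk : ∀ k : K, eval (cact k lam) P = eval lam P := by
    intro k
    have h := hP (k⁻¹ : K) (k⁻¹).2
    have h3 := eval_orthAct ((k⁻¹ : K) : Matrix.orthogonalGroup (Fin n) ℝ) P lam
    rw [h, Subgroup.coe_inv, inv_inv] at h3
    exact h3.symm
  rw [← h2, map_sum]
  have : ∑ k : K, Φ P (c k • eexp (cact k lam)) =
      eval lam P • ∑ k : K, c k • eexp (cact k lam) := by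
    rw [Finset.smul_sum]
    refine Finset.sum_congr rfl fun k _ => ?_
    rw [map_smul, Phi_eexp Φ h1, hk, smul_comm]
  rw [this]
  rfl

lemma mem_eigen {n : ℕ} (K : Subgroup (Matrix.orthogonalGroup (Fin n) ℝ)) (lam : Fin n → ℂ)
    [Fintype K] (hgen : ∀ g : Matrix.orthogonalGroup (Fin n) ℝ, g ∈ K → g ≠ 1 → cact g lam ≠ lam)
    (f : (Fin n → ℝ) → ℂ) (hf : f ∈ eigenSet K lam) :
    ∃ c : K → ℂ, f = ((∑ k : K, c k • eexp (cact k lam) : smoothSub n) : (Fin n → ℝ) → ℂ) := by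
  classical
  obtain ⟨Φ, h1, h2⟩ := exists_Phi n
  obtain ⟨a, ha⟩ := exists_sep K lam hgen
  choose p hp1 hp0 using exists_lagr K lam a ha
  obtain ⟨hs, hf⟩ := hf
  obtain ⟨f, rfl⟩ : ∃ f' : smoothSub n, (f' : (Fin n → ℝ) → ℂ) = f := ⟨⟨f, mem_smooth.2 hs⟩, rfl⟩
  have hann : ∀ q ∈ invIdeal K lam, Φ q f = 0 := by
    intro q hq
    induction hq using Submodule.span_induction with
    | mem q hq =>
      obtain ⟨P, hP, rfl⟩ := hq
      have e : Φ P f = eval lam P • f := by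
        apply Subtype.ext
        rw [h2, hf P hP]
        rfl
      rw [map_sub, LinearMap.sub_apply, e, ← algebraMap_eq, AlgHom.commutes]
      simp [Module.algebraMap_end_apply]
    | zero => simp
    | add x y _ _ hx hy => simp [hx, hy]
    | smul a x _ hx => rw [smul_eq_mul, map_mul, Module.End.mul_apply, hx, map_zero]
  have hz : ∀ q, (∀ g : K, eval (cact g lam) q = 0) → Φ q f = 0 := fun q hq =>
    hann q (invIdeal_radical K lam a ha q hq)
  have hpk : ∀ k h : K, eval (cact h lam) (p k) = if h = k then 1 else 0 := by
    intro k h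
    split_ifs with e
    · rw [e, hp1]
    · exact hp0 k h e
  have hsum : Φ (∑ k, p k - 1) f = 0 := hz _ fun g => by simp [hpk]
  have heig : ∀ k, ∃ c : ℂ, Φ (p k) f = c • eexp (cact k lam) := by
    intro k
    apply eq_smul_eexp
    intro i
    have h3 : Φ ((X i - C (cact k lam i)) * p k) f = 0 := hz _ fun g => by
      by_cases e : g = k
      · simp [e]
      · simp [hpk, e]
    rw [map_mul, map_sub, h1, ← algebraMap_eq, AlgHom.commutes, Module.End.mul_apply,
      LinearMap.sub_apply, Module.algebraMap_end_apply] at h3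
    exact sub_eq_zero.1 h3
  choose c hc using heig
  refine ⟨c, ?_⟩
  congr 1
  rw [map_sub, map_sum, map_one, LinearMap.sub_apply, sub_eq_zero, LinearMap.sum_apply] at hsum
  simp only [hc] at hsum
  exact hsum.symm

lemma eexp_indep {n : ℕ} (K : Subgroup (Matrix.orthogonalGroup (Fin n) ℝ)) (lam : Fin n → ℂ)
    [Fintype K] (hgen : ∀ g : Matrix.orthogonalGroup (Fin n) ℝ, g ∈ K → g ≠ 1 → cact g lam ≠ lam) :
    LinearIndependent ℂ (fun k : K => ((eexp (cact k lam) : smoothSub n) : (Fin n → ℝ) → ℂ)) := by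
  classical
  obtain ⟨Φ, h1, h2⟩ := exists_Phi n
  obtain ⟨a, ha⟩ := exists_sep K lam hgen
  choose p hp1 hp0 using exists_lagr K lam a ha
  rw [Fintype.linearIndependent_iff]
  intro c hc k
  have hc' : (∑ k : K, c k • eexp (cact k lam) : smoothSub n) = 0 := by
    apply Subtype.ext
    rw [← Submodule.subtype_apply, map_sum]
    exact hc
  have h3 := congrArg (Φ (p k)) hc'
  rw [map_sum, map_zero, Finset.sum_eq_single k] at h3
  · rw [map_smul, Phi_eexp Φ h1, hp1, one_smul] at h3
    have := congrArg (fun f : smoothSub n => (f : (Fin n → ℝ) → ℂ) 0) h3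
    simpa [eexp_apply] using this
  · intro h _ hh
    rw [map_smul, Phi_eexp Φ h1, hp0 k h hh, zero_smul, smul_zero]
  · simp

lemma natAct_eexp {n : ℕ} (K : Subgroup (Matrix.orthogonalGroup (Fin n) ℝ))
    (x₀ : Fin n → ℝ) (k₀ : K) (μ : Fin n → ℂ) :
    natAct K x₀ k₀ (eexp μ) = Complex.exp (- ∑ i, cact k₀ μ i * (x₀ i : ℂ)) •
      (eexp (cact k₀ μ) : (Fin n → ℝ) → ℂ) := by
  ext x
  simp only [natAct, Pi.smul_apply, eexp_apply, smul_eq_mul]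
  rw [← cact_pair, ← Complex.exp_add]
  congr 1
  simp only [Pi.sub_apply, Complex.ofReal_sub, mul_sub, Finset.sum_sub_distrib]
  ring

lemma natAct_sum {n : ℕ} (K : Subgroup (Matrix.orthogonalGroup (Fin n) ℝ))
    (x₀ : Fin n → ℝ) (k₀ : K) [Fintype K] (c : K → ℂ) (F : K → (Fin n → ℝ) → ℂ) :
    natAct K x₀ k₀ (∑ k, c k • F k) = ∑ k, c k • natAct K x₀ k₀ (F k) := by
  ext x
  simp [natAct]

lemma irred_aux {n : ℕ} (K : Subgroup (Matrix.orthogonalGroup (Fin n) ℝ)) (lam : Fin n → ℂ)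
    [Fintype K] (hgen : ∀ g : Matrix.orthogonalGroup (Fin n) ℝ, g ∈ K → g ≠ 1 → cact g lam ≠ lam)
    (W : Submodule ℂ ((Fin n → ℝ) → ℂ))
    (hW : ∀ (x₀ : Fin n → ℝ) (k₀ : K), ∀ f ∈ W, natAct K x₀ k₀ f ∈ W)
    (c : K → ℂ) (hc : ∑ k : K, c k • (eexp (cact k lam) : (Fin n → ℝ) → ℂ) ∈ W)
    (k : K) (hk : c k ≠ 0) (h : K) : (eexp (cact h lam) : (Fin n → ℝ) → ℂ) ∈ W := by
  classical
  have key : ∀ s : Finset K, k ∉ s → ∃ c : K → ℂ,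
      ∑ k : K, c k • (eexp (cact k lam) : (Fin n → ℝ) → ℂ) ∈ W ∧ c k ≠ 0 ∧ ∀ j ∈ s, c j = 0 := by
    intro s
    induction s using Finset.induction_on with
    | empty => exact fun _ => ⟨c, hc, hk, by simp⟩
    | insert j s _ ih =>
      intro hks
      simp only [Finset.mem_insert, not_or] at hks
      obtain ⟨d, hd, hdk, hds⟩ := ih hks.2
      obtain ⟨x, hx⟩ : ∃ x : Fin n → ℝ, Complex.exp (- ∑ i, cact k lam i * (x i : ℂ)) ≠
          Complex.exp (- ∑ i, cact j lam i * (x i : ℂ)) := by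
        by_contra hcon
        push Not at hcon
        apply hks.1
        apply cact_inj K lam hgen
        apply eexp_inj
        ext x
        rw [eexp_apply, eexp_apply]
        have := hcon x
        rwa [Complex.exp_neg, Complex.exp_neg, _root_.inv_inj] at this
      let χ : K → ℂ := fun k => Complex.exp (- ∑ i, cact k lam i * (x i : ℂ))
      refine ⟨fun l => d l * (χ l - χ j), ?_, mul_ne_zero hdk (sub_ne_zero.2 hx), ?_⟩
      · have h1 := W.sub_mem (hW x 1 _ hd) (W.smul_mem (χ j) hd)
        convert h1 using 1
        rw [natAct_sum, Finset.smul_sum, ← Finset.sum_sub_distrib]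
        refine Finset.sum_congr rfl fun l _ => ?_
        rw [natAct_eexp, Subgroup.coe_one, cact_one, smul_smul, smul_smul, ← sub_smul]
        congr 1
        simp only [χ]
        ring
      · intro l hl
        rcases Finset.mem_insert.1 hl with rfl | hl
        · simp
        · simp [hds l hl]
  obtain ⟨d, hd, hdk, hds⟩ := key (Finset.univ.erase k) (by simp)
  rw [Finset.sum_eq_single k (fun j _ hj => by rw [hds j (by simpa using hj), zero_smul])
    (by simp)] at hd
  have h1 := (W.smul_mem_iff hdk).1 hd
  have h2 := hW 0 (h * k⁻¹) _ h1
  rw [natAct_eexp, ← cact_mul, ← Subgroup.coe_mul, inv_mul_cancel_right] at h2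
  simpa using h2

lemma final_aux {n : ℕ} (K : Subgroup (Matrix.orthogonalGroup (Fin n) ℝ)) (lam : Fin n → ℂ)
    [Fintype K] (x₀ : Fin n → ℝ) (k₀ : K) (F : K → ℂ) :
    ∑ k : K, (Complex.exp (- ∑ i, cact k lam i * (x₀ i : ℂ)) • F (k₀⁻¹ * k)) •
      (eexp (cact k lam) : (Fin n → ℝ) → ℂ) =
    natAct K x₀ k₀ (∑ k : K, F k • (eexp (cact k lam) : (Fin n → ℝ) → ℂ)) := by
  rw [natAct_sum]
  symm
  refine Fintype.sum_equiv (Equiv.mulLeft k₀) _ _ fun k => ?_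
  have h1 : cact (k₀ : Matrix.orthogonalGroup (Fin n) ℝ) (cact k lam) = cact (k₀ * k : K) lam := by
    rw [Subgroup.coe_mul, cact_mul]
  rw [natAct_eexp, h1, show (Equiv.mulLeft k₀) k = k₀ * k from rfl]
  generalize hm : k₀ * k = m
  have h2 : k = k₀⁻¹ * m := by rw [← hm, inv_mul_cancel_left]
  rw [← h2, smul_smul, smul_eq_mul, mul_comm]

lemma basis_aux {ι : Type*} [Fintype ι] {n : ℕ} (v : ι → ((Fin n → ℝ) → ℂ))
    (hind : LinearIndependent ℂ v) (E : Set ((Fin n → ℝ) → ℂ)) (hmem : ∀ c : ι → ℂ, ∑ k, c k • v k ∈ E)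
    (hex : ∀ f ∈ E, ∃ c : ι → ℂ, f = ∑ k, c k • v k) :
    ∃ F : Fin (Nat.card ι) → ((Fin n → ℝ) → ℂ), (∀ i, F i ∈ E) ∧ LinearIndependent ℂ F ∧
      E = (Submodule.span ℂ (Set.range F) : Submodule ℂ ((Fin n → ℝ) → ℂ)) := by
  classical
  let e : Fin (Nat.card ι) ≃ ι := (Finite.equivFin ι).symm
  refine ⟨v ∘ e, ?_, hind.comp e e.injective, ?_⟩
  · intro i
    have := hmem (Pi.single (e i) 1)
    rwa [Finset.sum_eq_single (e i) (fun j _ hj => by rw [Pi.single_eq_of_ne hj, zero_smul])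
      (by simp), Pi.single_eq_same, one_smul] at this
  · rw [e.surjective.range_comp]
    ext f
    rw [SetLike.mem_coe, Submodule.mem_span_range_iff_exists_fun]
    constructor
    · intro hf
      obtain ⟨c, hc⟩ := hex f hf
      exact ⟨c, hc.symm⟩
    · rintro ⟨c, rfl⟩
      exact hmem c

/-- Let `K ≤ O(n)` be a finite pseudo-reflection group and `λ ∈ ℂⁿ`
generic (`g·λ ≠ λ` for `g ≠ e`) with purely imaginary coordinates.  Then the natural
representation `T_λ` of `G = ℝⁿ ⋊ K` on the joint eigenspace `E_λ` is irreducible, `E_λ`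
has dimension `|K|`, and `T_λ` is equivalent to `Ind_{ℝⁿ}^G χ`, `χ(x) = e^{−λᵀx}`,
realized on `K → ℂ` by `(ρ(x,k₀)F)(k) = χ(k⁻¹x)·F(k₀⁻¹k)`. -/
theorem stmt15 (n : ℕ) (K : Subgroup (Matrix.orthogonalGroup (Fin n) ℝ)) [Finite K]
    (hrefl : K = Subgroup.closure
      {g : Matrix.orthogonalGroup (Fin n) ℝ | g ∈ K ∧ ∃ c : ℂ, c ≠ 1 ∧
        ((g : Matrix (Fin n) (Fin n) ℝ).map (Complex.ofReal)).charpoly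
          = (Polynomial.X - Polynomial.C c) * (Polynomial.X - 1) ^ (n - 1)})
    (lam : Fin n → ℂ) (him : ∀ i, (lam i).re = 0)
    (hgen : ∀ g : Matrix.orthogonalGroup (Fin n) ℝ, g ∈ K → g ≠ 1 →
      ((g : Matrix (Fin n) (Fin n) ℝ).map (Complex.ofReal)).mulVec lam ≠ lam)
    (χ : (Fin n → ℝ) → ℂ)
    (hχ : ∀ x : Fin n → ℝ, χ x = Complex.exp (- ∑ i, lam i * (x i : ℂ))) :
    -- (a) T_λ is irreducible on E_λ
    (∀ W : Submodule ℂ ((Fin n → ℝ) → ℂ), (W : Set ((Fin n → ℝ) → ℂ)) ⊆ eigenSet K lam →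
      (∀ (x₀ : Fin n → ℝ) (k₀ : K), ∀ f ∈ W, natAct K x₀ k₀ f ∈ W) →
      W ≠ ⊥ → (W : Set ((Fin n → ℝ) → ℂ)) = eigenSet K lam) ∧
    -- (b) E_λ is a subspace of dimension |K|
    (∃ F : Fin (Nat.card K) → ((Fin n → ℝ) → ℂ),
      (∀ i, F i ∈ eigenSet K lam) ∧ LinearIndependent ℂ F ∧
      (eigenSet K lam = (Submodule.span ℂ (Set.range F) :
        Submodule ℂ ((Fin n → ℝ) → ℂ)))) ∧
    -- (c) T_λ is equivalent to the induced representation Ind_{ℝⁿ}^{ℝⁿ⋊K} χ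
    (∃ J : (K → ℂ) →ₗ[ℂ] ((Fin n → ℝ) → ℂ),
      Function.Injective J ∧ Set.range J = eigenSet K lam ∧
      ∀ (x₀ : Fin n → ℝ) (k₀ : K) (F : K → ℂ),
        J (fun k : K => χ ((((k : Matrix.orthogonalGroup (Fin n) ℝ)⁻¹ :
            Matrix.orthogonalGroup (Fin n) ℝ) : Matrix (Fin n) (Fin n) ℝ).mulVec x₀) •
          F (k₀⁻¹ * k))
          = natAct K x₀ k₀ (J F)) := by
  classical
  have := Fintype.ofFinite K
  have hgen' : ∀ g : Matrix.orthogonalGroup (Fin n) ℝ, g ∈ K → g ≠ 1 → cact g lam ≠ lam := hgen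
  have hcoe : ∀ c : K → ℂ, ((∑ k : K, c k • eexp (cact k lam) : smoothSub n) : (Fin n → ℝ) → ℂ) =
      ∑ k : K, c k • (eexp (cact k lam) : (Fin n → ℝ) → ℂ) := by
    intro c
    rw [← Submodule.subtype_apply, map_sum]
    rfl
  have hmem : ∀ c : K → ℂ, ∑ k : K, c k • (eexp (cact k lam) : (Fin n → ℝ) → ℂ) ∈
      eigenSet K lam := by
    intro c
    rw [← hcoe]
    exact eexp_mem K lam c
  have hex : ∀ f ∈ eigenSet K lam, ∃ c : K → ℂ,
      f = ∑ k : K, c k • (eexp (cact k lam) : (Fin n → ℝ) → ℂ) := by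
    intro f hf
    obtain ⟨c, hc⟩ := mem_eigen K lam hgen' f hf
    exact ⟨c, hc.trans (hcoe c)⟩
  have hind := eexp_indep K lam hgen'
  refine ⟨?_, ?_, ?_⟩
  · intro W hWE hW hne
    refine Set.Subset.antisymm hWE ?_
    obtain ⟨f, hf, hf0⟩ := W.ne_bot_iff.1 hne
    obtain ⟨c, rfl⟩ := hex f (hWE hf)
    obtain ⟨k, hk⟩ : ∃ k, c k ≠ 0 := by
      by_contra hcon
      push Not at hcon
      exact hf0 (by simp [hcon])
    intro f' hf'
    obtain ⟨d, rfl⟩ := hex f' hf'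
    exact W.sum_mem fun h _ => W.smul_mem _ (irred_aux K lam hgen' W hW c hf k hk h)
  · have h1 := basis_aux _ hind
    have h2 := h1 (eigenSet K lam) hmem hex
    exact h2
  · refine ⟨Fintype.linearCombination ℂ
      (fun k : K => (eexp (cact k lam) : (Fin n → ℝ) → ℂ)), ?_, ?_, ?_⟩
    · exact hind.fintypeLinearCombination_injective
    · ext f
      constructor
      · rintro ⟨c, rfl⟩
        rw [Fintype.linearCombination_apply]
        exact hmem c
      · intro hf
        obtain ⟨c, rfl⟩ := hex f hf
        exact ⟨c, Fintype.linearCombination_apply _ _ _⟩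
    · intro x₀ k₀ F
      have hχ' : ∀ k : K, χ ((((k : Matrix.orthogonalGroup (Fin n) ℝ)⁻¹ :
            Matrix.orthogonalGroup (Fin n) ℝ) : Matrix (Fin n) (Fin n) ℝ).mulVec x₀) =
          Complex.exp (- ∑ i, cact k lam i * (x₀ i : ℂ)) := by
        intro k
        rw [hχ, cact_pair (k : Matrix.orthogonalGroup (Fin n) ℝ) lam x₀]
      simp only [hχ']
      rw [Fintype.linearCombination_apply, Fintype.linearCombination_apply]
      exact final_aux K lam x₀ k₀ F

end
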